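/- The set of k-algebra homomorphisms kR(G) → k is exactly {ev̄_g : g ∈ G_{p'}}; for p-regular elements g, h one has ev̄_g = ev̄_h if and only if g and h are conjugate in G; and every simple kR(G)-module is one-dimensional over k (kR(G) is split). Hence the isomorphism classes of simple kR(G)-modules are in bijection with the p-regular conjugacy classes of G. -/

import Mathlib

open scoped TensorProduct Classical

/-! Common definitions: the character ring of a finite group, following Bonnafé,
"On the character ring of a finite group". -/

/-- The set of characters of finite-dimensional `K`-linear representations of `G`. -/
def charSet (K G : Type u) [Field K] [Group G] : Set (G → K) :=
  {f | ∃ V : FDRep K G, f = FDRep.character V}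

/-- The character ring `R(G)` of virtual characters, i.e. the subring of the `K`-algebra of
functions `G → K` generated by the characters.  Over a splitting field of characteristic zero
this is exactly the set of `ℤ`-linear combinations of irreducible characters. -/
def charRing (K G : Type u) [Field K] [Group G] : Subring (G → K) :=
  Subring.closure (charSet K G)

/-- `g` is `p`-regular if its order is prime to `p`. -/
def IsPRegular (p : ℕ) {G : Type*} [Monoid G] (g : G) : Prop :=
  Nat.Coprime (orderOf g) p

/-- `g` is a `p`-element if its order is a power of `p`. -/
def IsPElement (p : ℕ) {G : Type*} [Monoid G] (g : G) : Prop :=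
  ∃ n : ℕ, orderOf g = p ^ n

/-- The `p'`-part `g_{p'}` of an element `g` of a finite group:  writing `orderOf g = q * m'`
with `q` the `p`-part of the order, this is `g ^ (q * u)` where `u` is the inverse of
`q` modulo `m'`; it is the unique `p`-regular power of `g` such that `g * g_{p'}⁻¹` is a
`p`-element commuting with it. -/
noncomputable def pPrimePart (p : ℕ) {G : Type*} [Group G] (g : G) : G :=
  g ^ (p ^ (orderOf g).factorization p *
      (((p : ZMod (orderOf g / p ^ (orderOf g).factorization p)) ^
        (orderOf g).factorization p)⁻¹).val)

/-- The `p'`-section `S_{p'}(C)` of the conjugacy class `C` of `g` : the set of all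
`x ∈ G` whose `p'`-part lies in the class of `g`. -/
def pSection (p : ℕ) {G : Type*} [Group G] (g : G) : Set G :=
  {x | IsConj g (pPrimePart p x)}

/-- The idempotent class function `e_C` attached to the class `C` of `g`:  the characteristic
function (with values in `K`) of the `p'`-section of `C`. -/
noncomputable def eFun (p : ℕ) (K : Type*) [Field K] {G : Type*} [Group G] (g : G) : G → K :=
  fun x => if IsConj g (pPrimePart p x) then 1 else 0

/-- The number of conjugacy classes of `G` contained in a subset `S`. -/
noncomputable def numClassesIn {G : Type*} [Group G] (S : Set G) : ℕ :=
  Nat.card {c : ConjClasses G // c.carrier ⊆ S}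

/-- The image of the localization `𝒪_𝔭` in the fraction field `K`: fractions `a / b` with
`b ∉ 𝔭`. -/
def locSet (𝒪 K : Type*) [CommRing 𝒪] [Field K] [Algebra 𝒪 K] (𝔭 : Ideal 𝒪) : Set K :=
  {x | ∃ a b : 𝒪, b ∉ 𝔭 ∧ x * algebraMap 𝒪 K b = algebraMap 𝒪 K a}

/-- `𝒪_𝔭 R(G)`: the `𝒪_𝔭`-span of the character ring inside class functions `G → K`,
realized as the subring generated by `𝒪_𝔭`-constants and characters. -/
def locCharRing (𝒪 : Type*) (K : Type u) [CommRing 𝒪] [Field K] [Algebra 𝒪 K] (𝔭 : Ideal 𝒪)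
    (G : Type u) [Group G] : Subring (G → K) :=
  Subring.closure ({f | ∃ x ∈ locSet 𝒪 K 𝔭, f = Function.const G x} ∪ charSet K G)

/-- The ideal `𝔭 · 𝒪_𝔭R(G)` of `𝒪_𝔭R(G)`, generated by the constants from `𝔭`. -/
def pConstIdeal (𝒪 : Type*) (K : Type u) [CommRing 𝒪] [Field K] [Algebra 𝒪 K] (𝔭 : Ideal 𝒪)
    (G : Type u) [Group G] : Ideal (locCharRing 𝒪 K 𝔭 G) :=
  Ideal.span {f | ∃ a ∈ 𝔭, (f : G → K) = Function.const G (algebraMap 𝒪 K a)}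

/-- `kR(G) = k ⊗_ℤ R(G)`, realized through the canonical identification
`k ⊗_ℤ R(G) ≅ 𝒪_𝔭R(G) ⧸ 𝔭·𝒪_𝔭R(G)` (where `k = 𝒪/𝔭`). -/
abbrev kCharRing (𝒪 : Type*) (K : Type u) [CommRing 𝒪] [Field K] [Algebra 𝒪 K] (𝔭 : Ideal 𝒪)
    (G : Type u) [Group G] :=
  locCharRing 𝒪 K 𝔭 G ⧸ pConstIdeal 𝒪 K 𝔭 G

/-- The ideal of `𝒪_𝔭R(G)` cutting out the block `R_𝔭(G, C)` with identity element the
idempotent `e : 𝒪_𝔭R(G)`, reduced mod `𝔭`:  the block `kR(G)·ē` is canonically the quotient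
by `𝔭·𝒪_𝔭R(G) + (1 - e)·𝒪_𝔭R(G)`. -/
def blockIdeal (𝒪 : Type*) (K : Type u) [CommRing 𝒪] [Field K] [Algebra 𝒪 K] (𝔭 : Ideal 𝒪)
    (G : Type u) [Group G] (e : locCharRing 𝒪 K 𝔭 G) : Ideal (locCharRing 𝒪 K 𝔭 G) :=
  pConstIdeal 𝒪 K 𝔭 G ⊔ Ideal.span {1 - e}

/-- The block `kR_𝔭(G, C) = kR(G)·ē_C` of `kR(G)`, as a (unital) `k`-algebra, realized as the
quotient of `𝒪_𝔭R(G)` by `𝔭·𝒪_𝔭R(G) + (1 - e_C)·𝒪_𝔭R(G)`. -/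
abbrev blockAlg (𝒪 : Type*) (K : Type u) [CommRing 𝒪] [Field K] [Algebra 𝒪 K] (𝔭 : Ideal 𝒪)
    (G : Type u) [Group G] (e : locCharRing 𝒪 K 𝔭 G) :=
  locCharRing 𝒪 K 𝔭 G ⧸ blockIdeal 𝒪 K 𝔭 G e

/-- The constants, as a ring morphism `𝒪 →+* 𝒪_𝔭R(G)`. -/
noncomputable def constRingHom (𝒪 : Type*) (K : Type u) [CommRing 𝒪] [Field K] [Algebra 𝒪 K]
    (𝔭 : Ideal 𝒪) [𝔭.IsMaximal] (G : Type u) [Group G] : 𝒪 →+* locCharRing 𝒪 K 𝔭 G where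
  toFun a := ⟨Function.const G (algebraMap 𝒪 K a),
    Subring.subset_closure (Or.inl ⟨algebraMap 𝒪 K a,
      ⟨a, 1, fun h => (Ideal.ne_top_iff_one 𝔭).mp (Ideal.IsMaximal.ne_top ‹_›) h, by simp⟩, rfl⟩)⟩
  map_one' := Subtype.ext (funext fun g => by simp)
  map_mul' a b := Subtype.ext (funext fun g => by simp)
  map_zero' := Subtype.ext (funext fun g => by simp)
  map_add' a b := Subtype.ext (funext fun g => by simp)

/-- The structural morphism giving quotients of `𝒪_𝔭R(G)` by ideals containing
`𝔭·𝒪_𝔭R(G)` (such as `kR(G)` and its blocks) their `k = 𝒪/𝔭`-algebra structure. -/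
noncomputable def kScalars (𝒪 : Type*) (K : Type u) [CommRing 𝒪] [Field K] [Algebra 𝒪 K]
    (𝔭 : Ideal 𝒪) [𝔭.IsMaximal] (G : Type u) [Group G]
    (I : Ideal (locCharRing 𝒪 K 𝔭 G)) (hI : pConstIdeal 𝒪 K 𝔭 G ≤ I) :
    (𝒪 ⧸ 𝔭) →+* (locCharRing 𝒪 K 𝔭 G ⧸ I) :=
  Ideal.Quotient.lift 𝔭 ((Ideal.Quotient.mk I).comp (constRingHom 𝒪 K 𝔭 G))
    (fun a ha => by
      simp only [RingHom.comp_apply]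
      exact Ideal.Quotient.eq_zero_iff_mem.mpr (hI (Ideal.subset_span ⟨a, ha, rfl⟩)))

/-- The `k`-algebra structure morphism of the block `kR_𝔭(G, C)`. -/
noncomputable def blockScalars (𝒪 : Type*) (K : Type u) [CommRing 𝒪] [Field K] [Algebra 𝒪 K]
    (𝔭 : Ideal 𝒪) [𝔭.IsMaximal] (G : Type u) [Group G] (e : locCharRing 𝒪 K 𝔭 G) :
    (𝒪 ⧸ 𝔭) →+* blockAlg 𝒪 K 𝔭 G e :=
  kScalars 𝒪 K 𝔭 G (blockIdeal 𝒪 K 𝔭 G e) le_sup_left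

/-- The Jacobson radical of a ring. -/
noncomputable def jacRad (A : Type*) [CommRing A] : Ideal A := (⊥ : Ideal A).jacobson

/-- The Loewy length of `A`: the least `n` with `(Rad A) ^ n = 0`. -/
noncomputable def loewyLength (A : Type*) [CommRing A] : ℕ :=
  sInf {n : ℕ | jacRad A ^ n = ⊥}

/-- `Rad A / (Rad A)²`. -/
noncomputable abbrev radQuotient (A : Type*) [CommRing A] :=
  jacRad A ⧸ (Submodule.comap (jacRad A).subtype (jacRad A ^ 2 : Ideal A))

/-- `dim_k Rad(A)/Rad(A)²`, the `k`-vector space structure being induced by a ring morphism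
`k →+* A`. -/
noncomputable def extDim (k : Type*) [CommRing k] {A : Type*} [CommRing A] (φ : k →+* A) : ℕ :=
  letI : Module k (radQuotient A) := Module.compHom _ φ
  Module.finrank k (radQuotient A)

/-- `dim_k A`, the `k`-vector space structure being induced by a ring morphism `k →+* A`. -/
noncomputable def kDim (k : Type*) [CommRing k] {A : Type*} [CommRing A] (φ : k →+* A) : ℕ :=
  letI : Module k A := Module.compHom _ φ
  Module.finrank k A

/-- `dim_k I` for an ideal `I` of `A`, the `k`-vector space structure being induced by a ring
morphism `k →+* A`. -/
noncomputable def idealKDim (k : Type*) [CommRing k] {A : Type*} [CommRing A] (φ : k →+* A)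
    (I : Ideal A) : ℕ :=
  letI : Module k I := Module.compHom _ φ
  Module.finrank k I

variable {𝒪 : Type*} [CommRing 𝒪] [IsDomain 𝒪] [IsDedekindDomain 𝒪] [CharZero 𝒪]
variable {K : Type u} [Field K] [Algebra 𝒪 K] [IsFractionRing 𝒪 K]
variable {𝔭 : Ideal 𝒪} [𝔭.IsMaximal]

/-- `φ` is the `k`-algebra morphism `ev̄_g : kR(G) → k` induced by `χ ↦ χ(g) mod 𝔭`
(recall that character values lie in `𝒪`). -/
def IsEvBar {𝒪 : Type*} [CommRing 𝒪] {K : Type u} [Field K] [Algebra 𝒪 K] (𝔭 : Ideal 𝒪)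
    {G : Type u} [Group G] (g : G)
    (φ : ((𝒪 ⧸ 𝔭) ⊗[ℤ] charRing K G) →ₐ[𝒪 ⧸ 𝔭] (𝒪 ⧸ 𝔭)) : Prop :=
  ∀ (f : charRing K G) (a : 𝒪), (f : G → K) g = algebraMap 𝒪 K a →
    φ ((1 : 𝒪 ⧸ 𝔭) ⊗ₜ[ℤ] f) = Ideal.Quotient.mk 𝔭 a

section GeometricSums

variable {F : Type*} [Field F]

theorem geom_sum_of_pow_eq_one (n : ℕ) {x : F} (hx : x ^ n = 1) :
    ∑ i ∈ Finset.range n, x ^ i = if x = 1 then (n : F) else 0 := by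
  split_ifs with h
  · simp [h]
  · have := mul_geom_sum x n
    rw [hx, sub_self] at this
    exact (mul_eq_zero.mp this).resolve_left (sub_ne_zero.mpr h)

end GeometricSums

section TraceOfFiniteOrder

variable {F V : Type*} [Field F] [CharZero F] [AddCommGroup V] [Module F V]
  [FiniteDimensional F V]

/-- The projection of `V` onto the `a`-eigenspace of an endomorphism `T` satisfying `T ^ n = 1`
and a root of unity `a` with `a ^ n = 1`. -/
noncomputable def eigenProj (T : Module.End F V) (n : ℕ) (a : F) : Module.End F V :=
  (n : F)⁻¹ • ∑ j ∈ Finset.range n, (a⁻¹ • T) ^ j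

variable {T : Module.End F V} {n : ℕ} {a : F}

omit [CharZero F] [FiniteDimensional F V] in
theorem mul_eigenProj (hT : T ^ n = 1) (ha : a ^ n = 1) (ha0 : a ≠ 0) :
    T * eigenProj T n a = a • eigenProj T n a := by
  have h := mul_geom_sum (a⁻¹ • T) n
  rw [smul_pow, hT, inv_pow, ha, inv_one, one_smul, sub_self, sub_mul, one_mul, sub_eq_zero,
    smul_mul_assoc, inv_smul_eq_iff₀ ha0] at h
  rw [eigenProj, mul_smul_comm, h, smul_comm]

omit [CharZero F] [FiniteDimensional F V] in
theorem pow_mul_eigenProj (hT : T ^ n = 1) (ha : a ^ n = 1) (ha0 : a ≠ 0) (t : ℕ) :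
    T ^ t * eigenProj T n a = a ^ t • eigenProj T n a := by
  induction t with
  | zero => simp
  | succ t ih => rw [pow_succ, mul_assoc, mul_eigenProj hT ha ha0, mul_smul_comm, ih, smul_smul,
      pow_succ']

omit [FiniteDimensional F V] in
theorem isIdempotentElem_eigenProj (hn : n ≠ 0) (hT : T ^ n = 1) (ha : a ^ n = 1) (ha0 : a ≠ 0) :
    IsIdempotentElem (eigenProj T n a) := by
  have h : ∀ j, (a⁻¹ • T) ^ j * eigenProj T n a = eigenProj T n a := fun j => by
    rw [smul_pow, smul_mul_assoc, pow_mul_eigenProj hT ha ha0, smul_smul, ← mul_pow,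
      inv_mul_cancel₀ ha0, one_pow, one_smul]
  rw [IsIdempotentElem]
  conv_lhs => enter [1]; rw [eigenProj]
  rw [smul_mul_assoc, Finset.sum_mul, Finset.sum_congr rfl fun j _ => h j, Finset.sum_const,
    Finset.card_range, ← Nat.cast_smul_eq_nsmul F, smul_smul,
    inv_mul_cancel₀ (Nat.cast_ne_zero.mpr hn), one_smul]

omit [FiniteDimensional F V] in
theorem sum_eigenProj {ζ : F} (hn : n ≠ 0) (hζ : IsPrimitiveRoot ζ n) :
    ∑ i ∈ Finset.range n, eigenProj T n (ζ ^ i) = 1 := by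
  have hsum : ∀ j ∈ Finset.range n, ∑ i ∈ Finset.range n, ((ζ ^ i)⁻¹ • T) ^ j =
      (if j = 0 then (n : F) else 0) • T ^ j := fun j hj => by
    have h1 : ((ζ ^ j)⁻¹) ^ n = 1 := by
      rw [inv_pow, ← pow_mul, mul_comm, pow_mul, hζ.pow_eq_one, one_pow, inv_one]
    have h2 : (ζ ^ j)⁻¹ = 1 ↔ j = 0 := by
      rw [inv_eq_one, hζ.pow_eq_one_iff_dvd]
      exact ⟨fun h => Nat.eq_zero_of_dvd_of_lt h (Finset.mem_range.mp hj), fun h => h ▸ dvd_zero n⟩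
    simp only [← h2, ← geom_sum_of_pow_eq_one n h1, Finset.sum_smul]
    refine Finset.sum_congr rfl fun i _ => ?_
    rw [smul_pow, inv_pow, inv_pow, ← pow_mul, ← pow_mul, mul_comm]
  simp only [eigenProj]
  rw [← Finset.smul_sum, Finset.sum_comm, Finset.sum_congr rfl hsum,
    Finset.sum_eq_single_of_mem 0 (Finset.mem_range.mpr (Nat.pos_of_ne_zero hn))
      (fun j _ hj => by simp [hj])]
  simp [smul_smul, hn]

theorem exists_trace_pow_eq_aeval {ζ : F} (hn : n ≠ 0) (hζ : IsPrimitiveRoot ζ n)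
    (hT : T ^ n = 1) :
    ∃ q : Polynomial ℤ, ∀ t : ℕ, LinearMap.trace F V (T ^ t) = Polynomial.aeval (ζ ^ t) q := by
  have ha : ∀ i, (ζ ^ i) ^ n = 1 := fun i => by
    rw [← pow_mul, mul_comm, pow_mul, hζ.pow_eq_one, one_pow]
  have ha0 : ∀ i, ζ ^ i ≠ 0 := fun i => pow_ne_zero _ (hζ.ne_zero hn)
  refine ⟨∑ i ∈ Finset.range n, (Module.finrank F (LinearMap.range (eigenProj T n (ζ ^ i))) :
    Polynomial ℤ) * Polynomial.X ^ i, fun t => ?_⟩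
  rw [← mul_one (T ^ t), ← sum_eigenProj (T := T) hn hζ, Finset.mul_sum, map_sum, map_sum]
  refine Finset.sum_congr rfl fun i _ => ?_
  rw [pow_mul_eigenProj hT (ha i) (ha0 i), map_smul,
    (LinearMap.IsIdempotentElem.isProj_range _
      (isIdempotentElem_eigenProj hn hT (ha i) (ha0 i))).trace]
  simp only [map_mul, map_natCast, map_pow, Polynomial.aeval_X, smul_eq_mul]
  rw [← pow_mul, ← pow_mul, mul_comm, mul_comm i t]

end TraceOfFiniteOrder

theorem exists_charRing_apply_pow_eq_aeval {F G : Type u} [Field F] [CharZero F] [Group G]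
    [Finite G] {ζ : F} (hζ : IsPrimitiveRoot ζ (Nat.card G)) {f : G → F} (hf : f ∈ charRing F G)
    (g : G) : ∃ q : Polynomial ℤ, ∀ t : ℕ, f (g ^ t) = Polynomial.aeval (ζ ^ t) q := by
  induction hf using Subring.closure_induction with
  | mem f hf =>
    obtain ⟨V, rfl⟩ := hf
    obtain ⟨q, hq⟩ := exists_trace_pow_eq_aeval (T := V.ρ g) Nat.card_pos.ne' hζ
      (by rw [← map_pow, pow_card_eq_one', map_one])
    exact ⟨q, fun t => by rw [← hq, ← map_pow]; rfl⟩
  | zero => exact ⟨0, by simp⟩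
  | one => exact ⟨1, by simp⟩
  | add f₁ f₂ _ _ h₁ h₂ =>
    obtain ⟨q₁, h₁⟩ := h₁
    obtain ⟨q₂, h₂⟩ := h₂
    exact ⟨q₁ + q₂, fun t => by simp [h₁, h₂]⟩
  | neg f _ h =>
    obtain ⟨q, h⟩ := h
    exact ⟨-q, fun t => by simp [h]⟩
  | mul f₁ f₂ _ _ h₁ h₂ =>
    obtain ⟨q₁, h₁⟩ := h₁
    obtain ⟨q₂, h₂⟩ := h₂
    exact ⟨q₁ * q₂, fun t => by simp [h₁, h₂]⟩

section TwistedPermutationCharacters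

variable {F G Γ : Type*} [Field F] [Group G] [Group Γ]

/-- Right translation on functions `G → F`. -/
def rightTranslation (F G : Type*) [Field F] [Group G] : Representation F G (G → F) where
  toFun x := LinearMap.funLeft F F (· * x)
  map_one' := by ext; simp [LinearMap.funLeft_apply]
  map_mul' x y := by ext; simp [LinearMap.funLeft_apply, mul_assoc]

/-- Left translation on functions `G → F` along a homomorphism `θ : Γ →* G`, twisted by a linear
character of `Γ`. -/
def twistedLeftTranslation (θ : Γ →* G) (lam : Γ →* F) : Representation F Γ (G → F) where
  toFun γ := lam γ • LinearMap.funLeft F F (θ γ⁻¹ * ·)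
  map_one' := by ext; simp [LinearMap.funLeft_apply]
  map_mul' γ δ := by
    refine LinearMap.ext fun f => funext fun y => ?_
    simp [LinearMap.funLeft_apply, mul_assoc, mul_left_comm]

theorem trace_smul_funLeft {α : Type*} [Finite α] (c : F) (s : α → α) :
    LinearMap.trace F (α → F) (c • LinearMap.funLeft F F s) = c * Nat.card {y | s y = y} := by
  have := Fintype.ofFinite α
  rw [map_smul, LinearMap.trace_eq_matrix_trace F (Pi.basisFun F α), Matrix.trace, smul_eq_mul]
  simp [LinearMap.funLeft_apply, Pi.single_apply, Nat.card_eq_fintype_card, Fintype.card_subtype]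

theorem trace_translations [Finite G] (θ : Γ →* G) (lam : Γ →* F) (γ : Γ) (x : G) :
    LinearMap.trace F (G → F) (rightTranslation F G x * twistedLeftTranslation θ lam γ) =
      lam γ * Nat.card {y : G | y * x * y⁻¹ = θ γ} := by
  have h : rightTranslation F G x * twistedLeftTranslation θ lam γ =
      lam γ • LinearMap.funLeft F F (fun y => θ γ⁻¹ * (y * x)) := rfl
  rw [h, trace_smul_funLeft]
  congr 4
  ext y
  simp [inv_mul_eq_iff_eq_mul, mul_inv_eq_iff_eq_mul]

end TwistedPermutationCharacters

/-- If an idempotent endomorphism with range `W` commutes with a representation `ρ`, then the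
character of the subrepresentation `W` is given by the traces of its products with `ρ`. -/
theorem trace_mul_isProj_mem_charSet {F G V : Type u} [Field F] [Group G] [AddCommGroup V]
    [Module F V] [FiniteDimensional F V] (ρ : Representation F G V) {W : Submodule F V}
    {P : Module.End F V} (hP : LinearMap.IsProj W P) (hcomm : ∀ x, ρ x * P = P * ρ x) :
    (fun x => LinearMap.trace F V (ρ x * P)) ∈ charSet F G := by
  have hW : ∀ x, ∀ w ∈ W, ρ x w ∈ W := fun x w hw => by
    have := congrArg (· w) (hcomm x)
    simp only [Module.End.mul_apply, hP.map_id w hw] at this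
    exact this ▸ hP.map_mem _
  let σ : Representation F G W :=
    { toFun x := (ρ x).restrict (hW x)
      map_one' := by ext; simp
      map_mul' x y := by ext; simp }
  refine ⟨FDRep.of σ, funext fun x => ?_⟩
  change _ = LinearMap.trace F W ((ρ x).restrict (hW x))
  have hmem : ∀ v, (ρ x * P) v ∈ W := fun v => hW x _ (hP.map_mem v)
  rw [← LinearMap.trace_restrict_eq_of_forall_mem W _ hmem]
  congr 1
  ext w
  simp [hP.map_id w w.2]

theorem twisted_count_mem_charSet {F G : Type u} {Γ : Type*} [Field F] [CharZero F] [Group G]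
    [Finite G] [Group Γ] [Fintype Γ] (θ : Γ →* G) (lam : Γ →* F) :
    (fun x => (Nat.card Γ : F)⁻¹ * ∑ γ, lam γ * Nat.card {y : G | y * x * y⁻¹ = θ γ}) ∈
      charSet F G := by
  have : Invertible (Fintype.card Γ : F) :=
    invertibleOfNonzero (Nat.cast_ne_zero.mpr Fintype.card_ne_zero)
  have havg : (twistedLeftTranslation θ lam).averageMap =
      (Nat.card Γ : F)⁻¹ • ∑ γ, twistedLeftTranslation θ lam γ := by
    rw [Representation.averageMap, GroupAlgebra.average, map_smul, map_sum]
    simp [Nat.card_eq_fintype_card]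
  have hcomm : ∀ x γ, rightTranslation F G x * twistedLeftTranslation θ lam γ =
      twistedLeftTranslation θ lam γ * rightTranslation F G x := fun x γ => by
    refine LinearMap.ext fun f => funext fun y => ?_
    simp [rightTranslation, twistedLeftTranslation, LinearMap.funLeft_apply, mul_assoc]
  convert trace_mul_isProj_mem_charSet (rightTranslation F G)
    (twistedLeftTranslation θ lam).isProj_averageMap (fun x => ?_) using 2 with x
  · rw [havg, mul_smul_comm, map_smul, smul_eq_mul,
      Finset.mul_sum (f := fun γ => twistedLeftTranslation θ lam γ), map_sum]
    simp only [trace_translations]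
  · rw [havg, mul_smul_comm, smul_mul_assoc, Finset.mul_sum, Finset.sum_mul]
    simp only [hcomm]

theorem RingHom.exists_extension_of_isIntegral {R B L : Type*} [CommRing R] [CommRing B]
    [Algebra R B] [Algebra.IsIntegral R B] [Field L] [IsAlgClosed L]
    (hinj : Function.Injective (algebraMap R B)) (ψ : R →+* L) :
    ∃ τ : B →+* L, τ.comp (algebraMap R B) = ψ := by
  have : (RingHom.ker ψ).IsPrime := RingHom.ker_isPrime ψ
  obtain ⟨Q, -, hQ, hQψ⟩ := Ideal.exists_ideal_over_prime_of_isIntegral (RingHom.ker ψ)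
    (⊥ : Ideal B) (by rw [← RingHom.ker_eq_comap_bot, (RingHom.injective_iff_ker_eq_bot _).mp hinj]
                      exact bot_le)
  let := ψ.kerLift.toAlgebra
  let := (Ideal.quotientMap Q (algebraMap R B) hQψ.ge).toAlgebra
  have h₁ : Module.IsTorsionFree (R ⧸ RingHom.ker ψ) L :=
    Module.isTorsionFree_iff_algebraMap_injective.mpr ψ.kerLift_injective
  have h₂ : Module.IsTorsionFree (R ⧸ RingHom.ker ψ) (B ⧸ Q) :=
    Module.isTorsionFree_iff_algebraMap_injective.mpr (Ideal.quotientMap_injective' hQψ.le)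
  have h₃ : Algebra.IsIntegral (R ⧸ RingHom.ker ψ) (B ⧸ Q) := by
    refine ⟨fun b => ?_⟩
    obtain ⟨b, rfl⟩ := Ideal.Quotient.mk_surjective b
    obtain ⟨q, hq, hqb⟩ := Algebra.IsIntegral.isIntegral (R := R) b
    refine ⟨q.map (Ideal.Quotient.mk _), hq.map _, ?_⟩
    rw [Polynomial.eval₂_map]
    have := congrArg (Ideal.Quotient.mk Q) hqb
    rwa [Polynomial.hom_eval₂, map_zero] at this
  let e : B ⧸ Q →ₐ[R ⧸ RingHom.ker ψ] L := IsAlgClosed.lift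
  exact ⟨e.toRingHom.comp (Ideal.Quotient.mk Q), RingHom.ext fun r =>
    e.commutes (Ideal.Quotient.mk _ r)⟩

theorem IsPRegular.eq_one_of_conj_eq_mul {p : ℕ} [Fact p.Prime] {G : Type*} [Group G]
    {x y g u : G} (hx : IsPRegular p x) (hg : IsPRegular p g) (hgu : Commute g u)
    (hu : IsPElement p u) (h : y * x * y⁻¹ = g * u) : u = 1 := by
  obtain ⟨k, hk⟩ := hu
  have hcop : Nat.Coprime (orderOf g) (orderOf u) := hk ▸ Nat.Coprime.pow_right k hg
  have hord : orderOf x = orderOf g * orderOf u := by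
    rw [← hgu.orderOf_mul_eq_mul_orderOf_of_coprime hcop, ← h]
    exact ((MulAut.conj y).orderOf_eq x).symm
  have hup : Nat.Coprime (orderOf u) p := hx.of_dvd_left (hord ▸ dvd_mul_left _ _)
  rw [← orderOf_eq_one_iff]
  exact Nat.Coprime.eq_one_of_dvd (hup.pow_right k) hk.dvd

theorem exists_injective_zpowers_monoidHom {R G : Type*} [CommRing R] [IsDomain R] [Group G]
    [Finite G] {z : R} (hz : IsPrimitiveRoot z (Nat.card G)) (g : G) :
    ∃ lam : Subgroup.zpowers g →* R, Function.Injective lam := by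
  obtain ⟨d, hd⟩ := orderOf_dvd_natCard g
  have hω : IsPrimitiveRoot (z ^ d) (orderOf g) :=
    hz.pow Nat.card_pos (hd.trans (mul_comm _ _))
  have hm : orderOf g ≠ 0 := (orderOf_pos g).ne'
  obtain ⟨ω, hω'⟩ := hω.isUnit hm
  rw [← hω', IsPrimitiveRoot.coe_units_iff] at hω
  let γ : Subgroup.zpowers g := ⟨g, Subgroup.mem_zpowers g⟩
  have hγ : ∀ c : Subgroup.zpowers g, c ∈ Subgroup.zpowers γ := fun c => by
    obtain ⟨i, hi⟩ := c.2
    exact ⟨i, Subtype.ext (by simpa [γ] using hi)⟩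
  have hord : orderOf ω ∣ orderOf γ := by
    rw [← hω.eq_orderOf, Subgroup.orderOf_mk]
  refine ⟨(Units.coeHom R).comp (monoidHomOfForallMemZpowers hγ hord),
    (Units.val_injective).comp ((injective_iff_map_eq_one _).mpr fun c hc => ?_)⟩
  obtain ⟨i, rfl⟩ := hγ c
  simp only [map_zpow, monoidHomOfForallMemZpowers_apply_gen] at hc
  have := (hω.zpow_eq_one_iff_dvd i).mp hc
  exact Subtype.ext (by simpa [γ] using orderOf_dvd_iff_zpow_eq_one.mp this)

section Evaluation

omit [IsDomain 𝒪] [CharZero 𝒪] in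
theorem exists_isPrimitiveRoot_algebraMap_eq {ζ : K} {n : ℕ} (hn : n ≠ 0)
    (hζ : IsPrimitiveRoot ζ n) : ∃ z : 𝒪, algebraMap 𝒪 K z = ζ ∧ IsPrimitiveRoot z n := by
  obtain ⟨z, hz⟩ := IsIntegrallyClosed.algebraMap_eq_of_integral (R := 𝒪)
    ((hζ.isIntegral (Nat.pos_of_ne_zero hn)).tower_top)
  exact ⟨z, hz, IsPrimitiveRoot.of_map_of_injective (hz ▸ hζ) (IsFractionRing.injective 𝒪 K)⟩

variable {G : Type u} [Group G]

section Values

variable [Finite G] {z : 𝒪}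

omit [IsDomain 𝒪] [IsDedekindDomain 𝒪] in
theorem exists_charRing_apply_pow_eq_algebraMap_aeval
    (hz : IsPrimitiveRoot (algebraMap 𝒪 K z) (Nat.card G)) (f : charRing K G) (g : G) :
    ∃ q : Polynomial ℤ, ∀ t : ℕ,
      (f : G → K) (g ^ t) = algebraMap 𝒪 K (Polynomial.aeval (z ^ t) q) := by
  have : CharZero K := charZero_of_injective_algebraMap (IsFractionRing.injective 𝒪 K)
  obtain ⟨q, hq⟩ := exists_charRing_apply_pow_eq_aeval hz f.2 g
  exact ⟨q, fun t => by rw [hq, ← map_pow, Polynomial.aeval_algebraMap_apply]⟩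

omit [IsDomain 𝒪] [IsDedekindDomain 𝒪] in
theorem exists_evaluation_ringHom (hz : IsPrimitiveRoot (algebraMap 𝒪 K z) (Nat.card G)) (g : G) :
    ∃ e : charRing K G →+* 𝒪, ∀ f : charRing K G, algebraMap 𝒪 K (e f) = (f : G → K) g := by
  have h : ∀ f : charRing K G, ∃ a : 𝒪, algebraMap 𝒪 K a = (f : G → K) g := fun f => by
    obtain ⟨q, hq⟩ := exists_charRing_apply_pow_eq_algebraMap_aeval hz f g
    exact ⟨_, by rw [← hq 1, pow_one]⟩
  choose e he using h
  have hinj := IsFractionRing.injective 𝒪 K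
  exact ⟨{ toFun := e
           map_one' := hinj (by simp [he])
           map_mul' := fun a b => hinj (by simp [he])
           map_zero' := hinj (by simp [he])
           map_add' := fun a b => hinj (by simp [he]) }, he⟩

end Values

/-- A ring homomorphism `ψ` from `R(G)` to an extension of the residue field is the reduction of
evaluation at `g`. -/
def IsReducedEvaluation {L : Type*} [CommRing L] (ι : (𝒪 ⧸ 𝔭) →+* L) (g : G)
    (ψ : charRing K G →+* L) : Prop :=
  ∀ (f : charRing K G) (a : 𝒪), (f : G → K) g = algebraMap 𝒪 K a →
    ψ f = ι (Ideal.Quotient.mk 𝔭 a)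

omit [IsDomain 𝒪] [𝔭.IsMaximal] in
theorem exists_isReducedEvaluation_of_isAlgClosed [Finite G] {z : 𝒪} {L : Type*} [Field L]
    [IsAlgClosed L]
    (hz : IsPrimitiveRoot (algebraMap 𝒪 K z) (Nat.card G))
    (ι : (𝒪 ⧸ 𝔭) →+* L) (ψ : charRing K G →+* L) :
    ∃ g : G, IsReducedEvaluation ι g ψ := by
  have := Fintype.ofFinite G
  let B := integralClosure ℤ (G → K)
  have hn : Nat.card G ≠ 0 := Nat.card_pos.ne'
  have hconst : IsIntegral ℤ (algebraMap K (G → K) (algebraMap 𝒪 K z)) :=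
    (hz.isIntegral Nat.card_pos).algebraMap
  let c : B := ⟨_, hconst⟩
  have hsingle : ∀ g : G, IsIntegral ℤ (Pi.single g 1 : G → K) := fun g => by
    refine ⟨Polynomial.X ^ 2 - Polynomial.X, by monicity!, ?_⟩
    simp [sq, ← Pi.single_mul]
  let s : G → B := fun g => ⟨_, hsingle g⟩
  have hs : ∑ g, s g = 1 := by
    apply Subtype.ext
    ext x
    simp [s, Finset.sum_apply, Pi.single_apply]
  have hfs : ∀ (f : charRing K G) (g : G), ∃ q : Polynomial ℤ,
      (∀ t : ℕ, (f : G → K) (g ^ t) = algebraMap 𝒪 K (Polynomial.aeval (z ^ t) q)) ∧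
      (f : G → K) * s g = (Polynomial.aeval c q * s g : B) := fun f g => by
    obtain ⟨q, hq⟩ := exists_charRing_apply_pow_eq_algebraMap_aeval hz f g
    refine ⟨q, hq, funext fun x => ?_⟩
    rcases eq_or_ne x g with rfl | hx
    · have h1 := hq 1
      rw [pow_one, pow_one] at h1
      have h2 : ((Polynomial.aeval c q : B) : G → K) x =
          Polynomial.aeval (algebraMap 𝒪 K z) q := by
        have := Polynomial.aeval_algHom_apply
          ((Pi.evalAlgHom ℤ (fun _ : G => K) x).comp B.val) c q
        exact this.symm
      simp [s, h1, h2, Polynomial.aeval_algebraMap_apply]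
    · simp [s, hx]
  have hint : ∀ f : charRing K G, (f : G → K) ∈ B := fun f => by
    have : (f : G → K) = ((∑ g, Polynomial.aeval c (hfs f g).choose * s g : B) : G → K) := by
      rw [AddSubmonoidClass.coe_finsetSum, ← Finset.sum_congr rfl fun g _ => (hfs f g).choose_spec.2,
        ← Finset.mul_sum, ← AddSubmonoidClass.coe_finsetSum, hs]
      simp
    exact this ▸ Subtype.prop _
  let j : charRing K G →+* B := (charRing K G).subtype.codRestrict B hint
  let : Algebra (charRing K G) B := j.toAlgebra
  have : Algebra.IsIntegral (charRing K G) B := ⟨fun b => by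
    obtain ⟨q, hq, hqb⟩ := integralClosure.isIntegral (R := ℤ) b
    refine ⟨q.map (Int.castRingHom _), hq.map _, ?_⟩
    rw [Polynomial.eval₂_map, ← hqb]
    congr 1⟩
  obtain ⟨τ, hτ⟩ := RingHom.exists_extension_of_isIntegral
    (fun a b h => Subtype.ext (congrArg Subtype.val h : _) : Function.Injective j) ψ
  obtain ⟨g, hg⟩ : ∃ g, τ (s g) ≠ 0 := by
    by_contra! h
    have := congrArg τ hs
    simp [h] at this
  have hg1 : τ (s g) = 1 := by
    have : s g * s g = s g := Subtype.ext (by simp [s, ← Pi.single_mul])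
    have := congrArg τ this
    rw [map_mul] at this
    exact mul_right_cancel₀ hg (this.trans (one_mul _).symm)
  set w : L := ι (Ideal.Quotient.mk 𝔭 z)
  have hz' : IsPrimitiveRoot z (Nat.card G) := hz.of_map_of_injective (IsFractionRing.injective 𝒪 K)
  obtain ⟨t, ht⟩ : ∃ t : ℕ, τ c = w ^ t := by
    have hc : τ c ^ Nat.card G = 1 := by
      rw [← map_pow, ← map_one τ]
      congr 1
      refine Subtype.ext ?_
      change (algebraMap K (G → K) (algebraMap 𝒪 K z)) ^ Nat.card G = 1
      rw [← map_pow, hz.pow_eq_one, map_one]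
    have hprod := congrArg
      (fun q : Polynomial 𝒪 => (q.map (ι.comp (Ideal.Quotient.mk 𝔭))).eval (τ c))
      (Polynomial.X_pow_sub_one_eq_prod Nat.card_pos hz')
    simp only [Polynomial.map_sub, Polynomial.map_pow, Polynomial.map_X, Polynomial.map_one,
      Polynomial.map_prod, Polynomial.map_C, Polynomial.eval_sub, Polynomial.eval_pow,
      Polynomial.eval_X, Polynomial.eval_one, Polynomial.eval_prod, Polynomial.eval_C, hc,
      sub_self] at hprod
    obtain ⟨r, hr, hr0⟩ := Finset.prod_eq_zero_iff.mp hprod.symm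
    have : NeZero (Nat.card G) := ⟨hn⟩
    obtain ⟨t, -, rfl⟩ := hz'.eq_pow_of_pow_eq_one
      ((Polynomial.mem_nthRootsFinset Nat.card_pos _).mp hr)
    exact ⟨t, by rw [sub_eq_zero.mp hr0]; simp [w]⟩
  refine ⟨g ^ t, fun f a ha => ?_⟩
  obtain ⟨q, hq, hqs⟩ := hfs f g
  have hjf : j f * s g = Polynomial.aeval c q * s g := Subtype.ext hqs
  have hψ : ψ f = Polynomial.aeval (τ c) q := by
    have := congrArg τ hjf
    rw [map_mul, map_mul, hg1, mul_one, mul_one] at this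
    rw [← hτ]
    exact this.trans (Polynomial.aeval_algHom_apply τ.toIntAlgHom c q).symm
  have haq : a = Polynomial.aeval (z ^ t) q :=
    IsFractionRing.injective 𝒪 K (by rw [← ha, hq])
  rw [hψ, haq, ht]
  have := Polynomial.aeval_algHom_apply (ι.comp (Ideal.Quotient.mk 𝔭)).toIntAlgHom (z ^ t) q
  rw [map_pow] at this
  exact this

omit [IsDomain 𝒪] [𝔭.IsMaximal] in
theorem exists_isReducedEvaluation [Finite G] {z : 𝒪} {L : Type*} [Field L]
    (hz : IsPrimitiveRoot (algebraMap 𝒪 K z) (Nat.card G))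
    (ι : (𝒪 ⧸ 𝔭) →+* L) (ψ : charRing K G →+* L) :
    ∃ g : G, IsReducedEvaluation ι g ψ := by
  obtain ⟨g, hg⟩ := exists_isReducedEvaluation_of_isAlgClosed hz
    ((algebraMap L (AlgebraicClosure L)).comp ι) ((algebraMap L (AlgebraicClosure L)).comp ψ)
  exact ⟨g, fun f a ha => (algebraMap L (AlgebraicClosure L)).injective (hg f a ha)⟩

omit [IsDomain 𝒪] [IsDedekindDomain 𝒪] in
theorem IsReducedEvaluation.exists_isPRegular [Finite G] {z : 𝒪} {p : ℕ} [Fact p.Prime]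
    (hp : (p : 𝒪) ∈ 𝔭) {L : Type*} [CommRing L]
    (hz : IsPrimitiveRoot (algebraMap 𝒪 K z) (Nat.card G))
    {ι : (𝒪 ⧸ 𝔭) →+* L} {ψ : charRing K G →+* L} {g : G} (h : IsReducedEvaluation ι g ψ) :
    ∃ g' : G, IsPRegular p g' ∧ IsReducedEvaluation ι g' ψ := by
  have hpp : p.Prime := Fact.out
  let : Field (𝒪 ⧸ 𝔭) := Ideal.Quotient.field 𝔭
  have : CharP (𝒪 ⧸ 𝔭) p := (CharP.charP_iff_prime_eq_zero hpp).mpr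
    (by rw [← map_natCast (Ideal.Quotient.mk 𝔭)]; exact Ideal.Quotient.eq_zero_iff_mem.mpr hp)
  obtain ⟨a, m, hm, hn⟩ := Nat.exists_eq_pow_mul_and_not_dvd (n := Nat.card G) Nat.card_pos.ne' p
    hpp.ne_one
  have hcop : Nat.Coprime m p := ((Nat.Prime.coprime_iff_not_dvd hpp).mpr hm).symm
  obtain ⟨t, ht₀, ht₁⟩ := Nat.chineseRemainder (hcop.symm.pow_left a) 0 1
  have hz1 : Ideal.Quotient.mk 𝔭 z ^ m = 1 := by
    rw [← ExpChar.pow_prime_pow_mul_eq_one_iff p a, ← hn, ← map_pow,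
      (hz.of_map_of_injective (IsFractionRing.injective 𝒪 K)).pow_eq_one, map_one]
  have hzt : Ideal.Quotient.mk 𝔭 z ^ t = Ideal.Quotient.mk 𝔭 z := by
    have : t ≡ 1 [MOD orderOf (Ideal.Quotient.mk 𝔭 z)] :=
      ht₁.of_dvd (orderOf_dvd_of_pow_eq_one hz1)
    rw [← pow_mod_orderOf, this, pow_mod_orderOf, pow_one]
  refine ⟨g ^ t, hcop.of_dvd_left (orderOf_dvd_of_pow_eq_one ?_), fun f b hb => ?_⟩
  · rw [← pow_mul]
    refine orderOf_dvd_iff_pow_eq_one.mp ((orderOf_dvd_natCard g).trans ?_)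
    rw [hn]
    exact Nat.mul_dvd_mul_right ((Nat.modEq_zero_iff_dvd).mp ht₀) m
  · obtain ⟨q, hq⟩ := exists_charRing_apply_pow_eq_algebraMap_aeval hz f g
    have h1 := h f _ (by simpa using hq 1)
    have hbq : b = Polynomial.aeval (z ^ t) q :=
      IsFractionRing.injective 𝒪 K (by rw [← hb, hq])
    have hred : ∀ y : 𝒪, Ideal.Quotient.mk 𝔭 (Polynomial.aeval y q) =
        Polynomial.aeval (Ideal.Quotient.mk 𝔭 y) q := fun y =>
      (Polynomial.aeval_algHom_apply (Ideal.Quotient.mk 𝔭).toIntAlgHom y q).symm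
    rw [h1, hbq, hred, hred, map_pow, hzt]

omit [IsDedekindDomain 𝒪] in
/-- A combination of characters of `G`, with coefficients in `𝒪`, whose restriction to the
`p`-regular elements is a multiple of the indicator function of the conjugacy class of `g`. -/
theorem IsPRegular.exists_sum_charRing_eq_card [Finite G] {z : 𝒪} {p : ℕ} [Fact p.Prime]
    (hz : IsPrimitiveRoot (algebraMap 𝒪 K z) (Nat.card G)) {g : G} (hg : IsPRegular p g)
    (Q : Sylow p (Subgroup.centralizer {g})) :
    ∃ (c : ℕ → 𝒪) (χ : ℕ → charRing K G), ∀ x, IsPRegular p x →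
      ∑ j ∈ Finset.range (orderOf g), algebraMap 𝒪 K (c j) * (χ j : G → K) x =
        (Nat.card Q : K)⁻¹ * Nat.card {y : G | y * x * y⁻¹ = g} := by
  have : CharZero K := charZero_of_injective_algebraMap (IsFractionRing.injective 𝒪 K)
  have := Fintype.ofFinite G
  have := Fintype.ofFinite (Subgroup.zpowers g)
  have := Fintype.ofFinite Q
  obtain ⟨lam, hlam⟩ := exists_injective_zpowers_monoidHom
    (hz.of_map_of_injective (IsFractionRing.injective 𝒪 K)) g
  let γ : Subgroup.zpowers g := ⟨g, Subgroup.mem_zpowers g⟩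
  let κ : Q →* G := (Subgroup.centralizer {g}).subtype.comp
    (Q : Subgroup (Subgroup.centralizer {g})).subtype
  have hκ : ∀ u, Commute g (κ u) := fun u =>
    (Subgroup.mem_centralizer_singleton_iff.mp (u : Subgroup.centralizer {g}).2).symm
  let θ : Subgroup.zpowers g × Q →* G := (Subgroup.zpowers g).subtype.noncommCoprod κ
    fun c u => by
      obtain ⟨i, hi⟩ := c.2
      rw [Subgroup.subtype_apply, ← hi]
      exact (hκ u).zpow_left i
  let μ : ℕ → Subgroup.zpowers g × Q →* K := fun j =>
    (((algebraMap 𝒪 K : 𝒪 →* K).comp lam) ^ j).comp (MonoidHom.fst _ _)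
  refine ⟨fun j => lam γ⁻¹ ^ j,
    fun j => ⟨_, Subring.subset_closure (twisted_count_mem_charSet θ (μ j))⟩, fun x hx => ?_⟩
  have hgeom : ∀ c : Subgroup.zpowers g,
      ∑ j ∈ Finset.range (orderOf g), algebraMap 𝒪 K (lam (γ⁻¹ * c)) ^ j =
        if c = γ then (orderOf g : K) else 0 := fun c => by
    rw [geom_sum_of_pow_eq_one]
    · congr 1
      rw [map_eq_one_iff _ (IsFractionRing.injective 𝒪 K), map_eq_one_iff _ hlam,
        inv_mul_eq_one]
      exact propext eq_comm
    · rw [← map_pow, ← map_pow, ← Nat.card_zpowers, pow_card_eq_one', map_one, map_one]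
  have hcard : (Nat.card (Subgroup.zpowers g × Q) : K) = orderOf g * Nat.card Q := by
    rw [Nat.card_prod, Nat.card_zpowers, Nat.cast_mul]
  have hzero : ∀ u : Q, u ≠ 1 → Nat.card {y : G | y * x * y⁻¹ = g * κ u} = 0 := fun u hu => by
    rw [Nat.card_eq_zero]
    refine Or.inl ⟨fun ⟨y, hy⟩ => hu ?_⟩
    obtain ⟨k, hk⟩ := IsPGroup.iff_orderOf.mp Q.isPGroup' u
    have hinj : Function.Injective κ :=
      (Subgroup.subtype_injective _).comp (Subgroup.subtype_injective _)
    exact hinj ((hx.eq_one_of_conj_eq_mul hg (hκ u) ⟨k, by rw [orderOf_injective κ hinj, hk]⟩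
      hy).trans (map_one κ).symm)
  have hm : (orderOf g : K) ≠ 0 := Nat.cast_ne_zero.mpr (orderOf_pos g).ne'
  calc
    _ = (Nat.card (Subgroup.zpowers g × Q) : K)⁻¹ * ∑ v : Subgroup.zpowers g × Q,
          (∑ j ∈ Finset.range (orderOf g), algebraMap 𝒪 K (lam (γ⁻¹ * v.1)) ^ j) *
            Nat.card {y : G | y * x * y⁻¹ = θ v} := by
      simp only [Finset.sum_mul, Finset.mul_sum]
      rw [Finset.sum_comm]
      refine Finset.sum_congr rfl fun v _ => Finset.sum_congr rfl fun j _ => ?_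
      simp only [μ, map_mul, map_pow, mul_pow, MonoidHom.comp_apply, MonoidHom.pow_apply,
        MonoidHom.coe_fst, MonoidHom.coe_coe]
      ring
    _ = (Nat.card (Subgroup.zpowers g × Q) : K)⁻¹ * (orderOf g *
          Nat.card {y : G | y * x * y⁻¹ = g}) := by
      simp only [hgeom, Fintype.sum_prod_type, ite_mul, zero_mul]
      rw [Finset.sum_eq_single γ (fun c _ hc => by simp [hc]) (by simp),
        Finset.sum_eq_single 1 (fun u _ hu => ?_) (by simp)]
      · simp [θ, γ]
      · have := hzero u hu
        simp only [if_true, mul_eq_zero, Nat.cast_eq_zero]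
        exact Or.inr this
    _ = _ := by
      rw [hcard]
      field_simp

omit [IsDedekindDomain 𝒪] in
theorem IsPRegular.isConj_of_forall_sub_mem [Finite G] {z : 𝒪} {p : ℕ} [Fact p.Prime]
    (hp : (p : 𝒪) ∈ 𝔭) (hz : IsPrimitiveRoot (algebraMap 𝒪 K z) (Nat.card G)) {g h : G}
    (hg : IsPRegular p g) (hh : IsPRegular p h)
    (hgh : ∀ (f : charRing K G) (a b : 𝒪), (f : G → K) g = algebraMap 𝒪 K a →
      (f : G → K) h = algebraMap 𝒪 K b → a - b ∈ 𝔭) : IsConj g h := by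
  have : CharZero K := charZero_of_injective_algebraMap (IsFractionRing.injective 𝒪 K)
  by_contra hconj
  let C := Subgroup.centralizer {g}
  let Q : Sylow p C := default
  obtain ⟨c, χ, hχ⟩ := hg.exists_sum_charRing_eq_card hz Q
  obtain ⟨eg, heg⟩ := exists_evaluation_ringHom hz g
  obtain ⟨eh, heh⟩ := exists_evaluation_ringHom hz h
  have hcent : {y : G | y * g * y⁻¹ = g} = C := by
    ext y
    rw [SetLike.mem_coe, Subgroup.mem_centralizer_singleton_iff, Set.mem_ofPred_eq,
      mul_inv_eq_iff_eq_mul]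
  have hempty : {y : G | y * h * y⁻¹ = g} = ∅ :=
    Set.eq_empty_of_forall_notMem fun y hy => hconj (isConj_iff.mpr ⟨y, hy⟩).symm
  have hQ : (Nat.card Q : K) ≠ 0 := Nat.cast_ne_zero.mpr Nat.card_pos.ne'
  have hFg : ∑ j ∈ Finset.range (orderOf g), c j * eg (χ j) = ((Q : Subgroup C).index : 𝒪) := by
    apply IsFractionRing.injective 𝒪 K
    simp only [map_sum, map_mul, heg, hχ g hg, hcent, map_natCast]
    rw [inv_mul_eq_iff_eq_mul₀ hQ, ← Nat.cast_mul]
    exact congrArg _ (Subgroup.card_mul_index (Q : Subgroup C)).symm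
  have hFh : ∑ j ∈ Finset.range (orderOf g), c j * eh (χ j) = 0 := by
    apply IsFractionRing.injective 𝒪 K
    simp only [map_sum, map_mul, heh, hχ h hh, hempty, map_zero]
    simp
  have hmem : ((Q : Subgroup C).index : 𝒪) ∈ 𝔭 := by
    rw [← hFg, ← sub_zero (Finset.sum _ _), ← hFh, ← Finset.sum_sub_distrib]
    refine Ideal.sum_mem _ fun j _ => ?_
    rw [← mul_sub]
    exact Ideal.mul_mem_left _ _ (hgh (χ j) _ _ (heg _).symm (heh _).symm)
  have hcop : Nat.Coprime (Q : Subgroup C).index p :=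
    ((Nat.Prime.coprime_iff_not_dvd Fact.out).mpr Q.not_dvd_index).symm
  obtain ⟨a, b, hab⟩ := Nat.isCoprime_iff_coprime.mpr hcop
  refine (Ideal.ne_top_iff_one 𝔭).mp (Ideal.IsMaximal.ne_top ‹_›) ?_
  have := congrArg (Int.cast : ℤ → 𝒪) hab
  push_cast at this
  exact this ▸ Ideal.add_mem _ (Ideal.mul_mem_left _ _ hmem) (Ideal.mul_mem_left _ _ hp)

theorem charRing_apply_eq_of_isConj {F G : Type u} [Field F] [Group G] {f : G → F}
    (hf : f ∈ charRing F G) {g h : G} (hgh : IsConj g h) : f g = f h := by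
  obtain ⟨y, rfl⟩ := isConj_iff.mp hgh
  induction hf using Subring.closure_induction with
  | mem f hf =>
    obtain ⟨V, rfl⟩ := hf
    exact (FDRep.char_conj V g y).symm
  | zero => rfl
  | one => rfl
  | add a b _ _ ha hb => exact congrArg₂ (· + ·) ha hb
  | neg a _ ha => exact congrArg Neg.neg ha
  | mul a b _ _ ha hb => exact congrArg₂ (· * ·) ha hb

omit [IsDomain 𝒪] [𝔭.IsMaximal] in
theorem exists_sub_algebraMap_mem_of_isMaximal [Finite G] {z : 𝒪}
    (hz : IsPrimitiveRoot (algebraMap 𝒪 K z) (Nat.card G))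
    (𝔪 : Ideal ((𝒪 ⧸ 𝔭) ⊗[ℤ] charRing K G)) [𝔪.IsMaximal] (a : (𝒪 ⧸ 𝔭) ⊗[ℤ] charRing K G) :
    ∃ c : 𝒪 ⧸ 𝔭, a - algebraMap (𝒪 ⧸ 𝔭) _ c ∈ 𝔪 := by
  let : Field (((𝒪 ⧸ 𝔭) ⊗[ℤ] charRing K G) ⧸ 𝔪) := Ideal.Quotient.field 𝔪
  obtain ⟨g, hg⟩ := exists_isReducedEvaluation hz
    ((Ideal.Quotient.mk 𝔪).comp (algebraMap (𝒪 ⧸ 𝔭) _))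
    ((Ideal.Quotient.mk 𝔪).comp Algebra.TensorProduct.includeRight.toRingHom)
  obtain ⟨e, he⟩ := exists_evaluation_ringHom hz g
  induction a using TensorProduct.induction_on with
  | zero => exact ⟨0, by simp⟩
  | add a b ha hb =>
    obtain ⟨c, hc⟩ := ha
    obtain ⟨d, hd⟩ := hb
    exact ⟨c + d, by rw [map_add, add_sub_add_comm]; exact 𝔪.add_mem hc hd⟩
  | tmul c f =>
    refine ⟨c * Ideal.Quotient.mk 𝔭 (e f), ?_⟩
    have hf := Ideal.Quotient.eq.mp (hg f (e f) (he f).symm)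
    have hc : c ⊗ₜ[ℤ] f = algebraMap (𝒪 ⧸ 𝔭) ((𝒪 ⧸ 𝔭) ⊗[ℤ] charRing K G) c *
        Algebra.TensorProduct.includeRight f := by
      simp [Algebra.TensorProduct.algebraMap_apply]
    rw [hc, map_mul, ← mul_sub]
    exact 𝔪.mul_mem_left _ hf

omit [IsDomain 𝒪] in
theorem finrank_eq_one_of_isSimpleModule [Finite G] {z : 𝒪}
    (hz : IsPrimitiveRoot (algebraMap 𝒪 K z) (Nat.card G))
    (M : Type*) [AddCommGroup M] [Module ((𝒪 ⧸ 𝔭) ⊗[ℤ] charRing K G) M]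
    [IsSimpleModule ((𝒪 ⧸ 𝔭) ⊗[ℤ] charRing K G) M] :
    letI : Module (𝒪 ⧸ 𝔭) M :=
      Module.compHom M (algebraMap (𝒪 ⧸ 𝔭) ((𝒪 ⧸ 𝔭) ⊗[ℤ] charRing K G))
    Module.finrank (𝒪 ⧸ 𝔭) M = 1 := by
  let : Field (𝒪 ⧸ 𝔭) := Ideal.Quotient.field 𝔭
  let : Module (𝒪 ⧸ 𝔭) M :=
    Module.compHom M (algebraMap (𝒪 ⧸ 𝔭) ((𝒪 ⧸ 𝔭) ⊗[ℤ] charRing K G))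
  have := IsSimpleModule.annihilator_isMaximal (R := (𝒪 ⧸ 𝔭) ⊗[ℤ] charRing K G) (M := M)
  have := IsSimpleModule.nontrivial ((𝒪 ⧸ 𝔭) ⊗[ℤ] charRing K G) M
  obtain ⟨m, hm⟩ := exists_ne (0 : M)
  refine (finrank_eq_one_iff_of_nonzero' m hm).mpr fun w => ?_
  obtain ⟨a, rfl⟩ := IsSimpleModule.toSpanSingleton_surjective
    ((𝒪 ⧸ 𝔭) ⊗[ℤ] charRing K G) hm w
  obtain ⟨c, hc⟩ := exists_sub_algebraMap_mem_of_isMaximal hz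
    (Module.annihilator ((𝒪 ⧸ 𝔭) ⊗[ℤ] charRing K G) M) a
  refine ⟨c, ?_⟩
  have := Module.mem_annihilator.mp hc m
  rw [sub_smul, sub_eq_zero] at this
  exact this.symm

end Evaluation

/-- The set of `k`-algebra homomorphisms `kR(G) → k` is exactly
`{ev̄_g : g ∈ G_{p'}}`; for `p`-regular `g, h` one has `ev̄_g = ev̄_h` iff `g` and `h` are
conjugate; and every simple `kR(G)`-module is one-dimensional over `k`. -/
theorem algHoms_of_kCharRing
    (p : ℕ) [Fact p.Prime] (hp : (p : 𝒪) ∈ 𝔭)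
    {G : Type u} [Group G] [Finite G]
    (ζ : K) (hζ : IsPrimitiveRoot ζ (Nat.card G)) :
    (∀ φ : ((𝒪 ⧸ 𝔭) ⊗[ℤ] charRing K G) →ₐ[𝒪 ⧸ 𝔭] (𝒪 ⧸ 𝔭),
        ∃ g : G, IsPRegular p g ∧ IsEvBar 𝔭 g φ) ∧
    (∀ g : G, IsPRegular p g →
        ∃ φ : ((𝒪 ⧸ 𝔭) ⊗[ℤ] charRing K G) →ₐ[𝒪 ⧸ 𝔭] (𝒪 ⧸ 𝔭), IsEvBar 𝔭 g φ) ∧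
    (∀ g h : G, IsPRegular p g → IsPRegular p h →
        ∀ φ ψ : ((𝒪 ⧸ 𝔭) ⊗[ℤ] charRing K G) →ₐ[𝒪 ⧸ 𝔭] (𝒪 ⧸ 𝔭),
          IsEvBar 𝔭 g φ → IsEvBar 𝔭 h ψ → (φ = ψ ↔ IsConj g h)) ∧
    (∀ (M : Type u) [AddCommGroup M] [Module ((𝒪 ⧸ 𝔭) ⊗[ℤ] charRing K G) M],
        IsSimpleModule ((𝒪 ⧸ 𝔭) ⊗[ℤ] charRing K G) M →
        letI : Module (𝒪 ⧸ 𝔭) M :=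
          Module.compHom M (algebraMap (𝒪 ⧸ 𝔭) ((𝒪 ⧸ 𝔭) ⊗[ℤ] charRing K G))
        Module.finrank (𝒪 ⧸ 𝔭) M = 1) := by
  have hinj := IsFractionRing.injective 𝒪 K
  obtain ⟨z, rfl, -⟩ := exists_isPrimitiveRoot_algebraMap_eq (𝒪 := 𝒪) Nat.card_pos.ne' hζ
  refine ⟨fun φ => ?_, fun g _ => ?_, fun g h hg hh φ ψ hφ hψ => ⟨?_, fun hgh => ?_⟩,
    fun M _ _ hM => finrank_eq_one_of_isSimpleModule hζ M⟩
  · let : Field (𝒪 ⧸ 𝔭) := Ideal.Quotient.field 𝔭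
    obtain ⟨g, hg⟩ := exists_isReducedEvaluation hζ (RingHom.id (𝒪 ⧸ 𝔭))
      (φ.toRingHom.comp Algebra.TensorProduct.includeRight.toRingHom)
    exact hg.exists_isPRegular hp hζ
  · obtain ⟨e, he⟩ := exists_evaluation_ringHom hζ g
    let ε : charRing K G →ₐ[ℤ] 𝒪 ⧸ 𝔭 :=
      { (Ideal.Quotient.mk 𝔭).comp e with commutes' := fun r => by simp }
    refine ⟨AlgHom.liftEquiv ℤ (𝒪 ⧸ 𝔭) (charRing K G) (𝒪 ⧸ 𝔭) ε, fun f a ha => ?_⟩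
    rw [AlgHom.liftEquiv_tmul, one_smul, ← hinj ((he f).trans ha)]
    rfl
  · rintro rfl
    refine hg.isConj_of_forall_sub_mem hp hζ hh fun f a b ha hb => ?_
    rw [← Ideal.Quotient.eq, ← hφ f a ha, hψ f b hb]
  · obtain ⟨e, he⟩ := exists_evaluation_ringHom hζ g
    refine Algebra.TensorProduct.ext_ring (AlgHom.ext fun f => ?_)
    exact (hφ f (e f) (he f).symm).trans
      (hψ f (e f) ((charRing_apply_eq_of_isConj f.2 hgh).symm.trans (he f).symm)).symm
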